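/- Let p be a prime number and let Γ be a congruence subgroup of SL₂(ℤ) of level p, i.e. p is the smallest n ≥ 1 with Γ(n) ≤ Γ. Assume it is not the case that both p ∈ {2, 3, 5, 7, 11} and the index of Γ in SL₂(ℤ) equals p. Then Γ is an origami Veech group: there exists a finite index subgroup U of F₂ with Γ = Γ(U). -/

import Mathlib

/-- The free group on two generators. -/
abbrev F2 := FreeGroup (Fin 2)

/-- The generator `x` of `F₂`. -/
def xg : F2 := FreeGroup.of 0

/-- The generator `y` of `F₂`. -/
def yg : F2 := FreeGroup.of 1

/-- The exponent sum of the `i`-th generator, i.e. the `i`-th coordinate of the image in the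
abelianization `ℤ²` of `F₂`. -/
def expSum (i : Fin 2) : F2 →* Multiplicative ℤ :=
  FreeGroup.lift fun j => Multiplicative.ofAdd (if j = i then (1 : ℤ) else 0)

/-- The matrix in `GL₂(ℤ)` induced by an automorphism `γ` of `F₂` on the abelianization
`F₂^ab ≅ ℤ²` (with basis the images of `x` and `y`); i.e. `β̂(γ)`. -/
def autMat (γ : F2 ≃* F2) : Matrix (Fin 2) (Fin 2) ℤ :=
  Matrix.of fun i j => Multiplicative.toAdd (expSum i (γ (FreeGroup.of j)))

abbrev SL2Z := Matrix.SpecialLinearGroup (Fin 2) ℤ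

/-- `Stab(V) = {γ ∈ Aut⁺(F₂) : γ(V) = V}`. -/
def StabSet (V : Subgroup F2) : Set (F2 ≃* F2) :=
  { γ | (autMat γ).det = 1 ∧ Subgroup.map γ.toMonoidHom V = V }

/-- The Veech group `Γ(V) = β̂(Stab(V)) ⊆ SL₂(ℤ)` of a subgroup `V` of `F₂`. -/
def VeechGroup (V : Subgroup F2) : Set SL2Z :=
  { A | ∃ γ : F2 ≃* F2, γ ∈ StabSet V ∧ (A : Matrix (Fin 2) (Fin 2) ℤ) = autMat γ }

/-- A set of elements of `SL₂(ℤ)` is a congruence group if it contains the principal congruence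
subgroup `Γ(n)` for some `n ≥ 1`. -/
def IsCongruenceSet (S : Set SL2Z) : Prop :=
  ∃ n : ℕ, 1 ≤ n ∧ (CongruenceSubgroup.Gamma n : Set SL2Z) ⊆ S

/-- The subgroup of `Multiplicative ℤ` of elements divisible by `n`. -/
def divSub (n : ℤ) : Subgroup (Multiplicative ℤ) where
  carrier := {d | n ∣ Multiplicative.toAdd d}
  one_mem' := dvd_zero n
  mul_mem' := fun ha hb => dvd_add ha hb
  inv_mem' := fun ha => dvd_neg.mpr ha

/-- The subgroup `Hₙ = {u ∈ U : n ∣ α(u)}` of `F₂` (for `n = 0` this is `ker α = H₀`). -/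
def Hgrp {U : Subgroup F2} (α : U →* Multiplicative ℤ) (n : ℕ) : Subgroup F2 :=
  Subgroup.map U.subtype (Subgroup.comap α (divSub (n : ℤ)))

/-- The subgroup `U_L` of `F₂` corresponding to the origami `L(2,3)`. -/
def UL : Subgroup F2 :=
  Subgroup.closure {xg ^ 3, xg * yg * xg⁻¹, xg ^ 2 * yg * (xg ^ 2)⁻¹, yg * xg * yg⁻¹, yg ^ 2}

/-- The subgroup `U_D` of `F₂` corresponding to the origami `D`. -/
def UD : Subgroup F2 :=
  Subgroup.closure {xg ^ 3, xg * yg * (xg ^ 2)⁻¹, xg ^ 2 * yg * xg⁻¹, yg * xg * yg⁻¹,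
    yg ^ 2 * xg * (yg ^ 2)⁻¹, yg ^ 3}

/-- A set of matrices in `SL₂(F)`, given by a predicate on the four entries `a, b, c, d`, which is
a subgroup acting simply transitively on the nonzero column vectors. -/
structure IsColumnRegular {F : Type*} [Field F] (P : F → F → F → F → Prop) : Prop where
  mul : ∀ {a b c d a' b' c' d'}, P a b c d → P a' b' c' d' →
    P (a * a' + b * c') (a * b' + b * d') (c * a' + d * c') (c * b' + d * d')
  inv : ∀ {a b c d}, P a b c d → P d (-b) (-c) a
  det : ∀ {a b c d}, P a b c d → a * d - b * c = 1
  trans : ∀ a c, ¬ (a = 0 ∧ c = 0) → ∃ b d, P a b c d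
  unip : ∀ {t}, P 1 t 0 1 → t = 0

namespace IsColumnRegular

variable {F : Type*} [Field F] {P : F → F → F → F → Prop}

theorem unique (hP : IsColumnRegular P) {a b c d b' d' : F} (h : P a b c d) (h' : P a b' c d') :
    b = b' ∧ d = d' := by
  have h1 := hP.mul (hP.inv h) h'
  have e := hP.det h
  have e' := hP.det h'
  rw [show d * a + -b * c = 1 by linear_combination e, show -c * a + a * c = 0 by ring,
    show -c * b' + a * d' = 1 by linear_combination e'] at h1
  have h2 : d * b' = b * d' := by linear_combination hP.unip h1
  constructor
  · linear_combination b' * e - b * e' - a * h2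
  · linear_combination d' * e - d * e' - c * h2

theorem conj (hP : IsColumnRegular P) (t : F) :
    IsColumnRegular fun a b c d => P (a - t * c) ((a - t * c) * t + b - t * d) c (c * t + d) where
  mul h h' := by
    convert hP.mul h h' using 1 <;> ring
  inv h := by
    convert hP.inv h using 1 <;> ring
  det h := by
    linear_combination hP.det h
  trans a c h := by
    obtain ⟨b, d, hbd⟩ := hP.trans (a - t * c) c (by
      rintro ⟨h1, h2⟩
      exact h ⟨by rw [h2] at h1; linear_combination h1, h2⟩)
    refine ⟨b + t * (d - c * t) - (a - t * c) * t, d - c * t, ?_⟩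
    convert hbd using 1 <;> ring
  unip h := hP.unip (by convert h using 1 <;> ring)

theorem diag_of_generator (hP : IsColumnRegular P) [Finite F] {g : Fˣ}
    (hg : ∀ u, u ∈ Subgroup.zpowers g) (h : P g 0 0 (g : F)⁻¹) (u : Fˣ) : P u 0 0 (u : F)⁻¹ := by
  obtain ⟨n, rfl⟩ := (Submonoid.mem_powers_iff _ _).1 ((mem_powers_iff_mem_zpowers).2 (hg u))
  induction n with
  | zero =>
    convert hP.mul h (hP.inv h) using 1 <;> simp
  | succ n ih =>
    convert hP.mul ih h using 1 <;> simp [pow_succ, mul_comm]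

theorem exists_diag {p : ℕ} [Fact p.Prime] (hp : 5 ≤ p)
    {P : ZMod p → ZMod p → ZMod p → ZMod p → Prop}
    (hP : IsColumnRegular P) :
    ∃ Q : ZMod p → ZMod p → ZMod p → ZMod p → Prop, IsColumnRegular Q ∧
      ∀ s, s ≠ 0 → Q s 0 0 s⁻¹ := by
  obtain ⟨g, hg⟩ := IsCyclic.exists_generator (α := (ZMod p)ˣ)
  have hg2 : (g : ZMod p) ^ 2 ≠ 1 := by
    intro h
    have h1 : g ^ 2 = 1 := by ext; simpa using h
    have h2 : orderOf g ∣ 2 := orderOf_dvd_of_pow_eq_one h1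
    rw [orderOf_eq_card_of_forall_mem_zpowers hg, Nat.card_eq_fintype_card, ZMod.card_units] at h2
    have := Nat.le_of_dvd (by norm_num) h2
    omega
  have hg0 : (g : ZMod p) ≠ 0 := g.ne_zero
  have hg3 : (g : ZMod p) - (g : ZMod p)⁻¹ ≠ 0 := by
    intro h
    apply hg2
    field_simp at h
    linear_combination h
  obtain ⟨b, d, h⟩ := hP.trans g 0 (by simp [hg0])
  have hd : d = (g : ZMod p)⁻¹ := by
    have := hP.det h
    field_simp
    linear_combination this
  subst hd
  have hQ := hP.conj (b / ((g : ZMod p) - (g : ZMod p)⁻¹))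
  refine ⟨_, hQ, ?_⟩
  set t := b / ((g : ZMod p) - (g : ZMod p)⁻¹) with ht
  have htb : t * ((g : ZMod p) - (g : ZMod p)⁻¹) = b := by rw [ht]; field_simp
  set Q : ZMod p → ZMod p → ZMod p → ZMod p → Prop :=
    fun a b c d => P (a - t * c) ((a - t * c) * t + b - t * d) c (c * t + d) with hQd
  have hgQ : Q g 0 0 (g : ZMod p)⁻¹ := by
    rw [hQd]
    convert h using 1
    · ring
    · linear_combination htb
    · ring
  exact fun s hs => hQ.diag_of_generator hg hgQ (Units.mk0 s hs)

/-- The entries of the elements of a column-regular group with second row `(1, *)` satisfy a strong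
algebraic constraint. -/
theorem exists_constants (hP : IsColumnRegular P) (hdiag : ∀ s, s ≠ 0 → P s 0 0 s⁻¹)
    (hF : ∃ s : F, s ≠ 0 ∧ s ^ 2 ≠ 1) (x₀ : F) (hx₀ : x₀ ≠ 0)
    (hsq : ∀ x : F, x ≠ 0 → ∃ s, s ≠ 0 ∧ (x = s ^ 2 ∨ x = s ^ 2 * x₀)) :
    ∃ c d : F, (c ≠ 0 ∧ c ≠ 1) ∧ (d ≠ 0 ∧ d ≠ 1) ∧
      (∀ s, s ≠ 0 → s ^ 2 + c ≠ 0 →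
        (s ^ 2 + c - 1) * (c ^ 2 + (c - 1) * s ^ 2) = 0 ∨
        (s ^ 2 + c - 1) * (c ^ 2 + (c - 1) * s ^ 2) = c * s ^ 2 ∨
        (s ^ 2 + c - 1) * (c ^ 2 + (c - 1) * s ^ 2) = d * s ^ 2) ∧
      (∀ s, s ≠ 0 → s ^ 2 + d ≠ 0 →
        (s ^ 2 + d - 1) * (d ^ 2 + (d - 1) * s ^ 2) = 0 ∨
        (s ^ 2 + d - 1) * (d ^ 2 + (d - 1) * s ^ 2) = c * s ^ 2 ∨
        (s ^ 2 + d - 1) * (d ^ 2 + (d - 1) * s ^ 2) = d * s ^ 2) := by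
  have hw : P 0 (-1) 1 0 := by
    obtain ⟨b, e, h⟩ := hP.trans 0 1 (by simp)
    have hb : b = -1 := by linear_combination -hP.det h
    subst hb
    obtain ⟨s, hs, hs2⟩ := hF
    have h1 := hP.mul (hP.mul (hdiag s hs) h) (hdiag s hs)
    simp only [mul_zero, zero_mul, add_zero, zero_add, mul_one, inv_mul_cancel₀ hs] at h1
    have h2 := (hP.unique h h1).2
    have : e = 0 := by
      field_simp at h2
      have h3 : e * (s ^ 2 - 1) = 0 := by linear_combination h2
      exact (mul_eq_zero.1 h3).resolve_right (sub_ne_zero.2 hs2)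
    rwa [this] at h
  have hex : ∀ x : F, ∃ z, P x (x * z - 1) 1 z := by
    intro x
    obtain ⟨b, z, h⟩ := hP.trans x 1 (by simp)
    have := hP.det h
    rw [show b = x * z - 1 by linear_combination -this] at h
    exact ⟨z, h⟩
  choose ψ hψ using hex
  have hψu : ∀ {x b z}, P x b 1 z → ψ x = z := fun h => (hP.unique (hψ _) h).2
  have hψs : ∀ s x, s ≠ 0 → (s ^ 2 * x) * ψ (s ^ 2 * x) = x * ψ x := by
    intro s x hs
    have h1 := hP.mul (hP.mul (hdiag s hs) (hψ x)) (hdiag s hs)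
    simp only [mul_zero, zero_mul, add_zero, zero_add, mul_one, inv_mul_cancel₀ hs] at h1
    rw [show s * x * s = s ^ 2 * x by ring] at h1
    rw [hψu h1]
    field_simp
  have hval : ∀ x, x * ψ x = 0 ∨ x * ψ x = 1 * ψ 1 ∨ x * ψ x = x₀ * ψ x₀ := by
    intro x
    by_cases hx : x = 0
    · simp [hx]
    · obtain ⟨s, hs, rfl | rfl⟩ := hsq x hx
      · right; left
        simpa using hψs s 1 hs
      · right; right
        exact hψs s x₀ hs
  have hne : ∀ x, x ≠ 0 → x * ψ x ≠ 0 ∧ x * ψ x ≠ 1 := by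
    intro x hx
    have h := hψ x
    constructor
    · intro h0
      have h1 := hP.mul h (hP.inv hw)
      have hz : ψ x = 0 := (mul_eq_zero.1 h0).resolve_left hx
      rw [hz] at h1
      have h2 := hP.unip (t := x) (by convert h1 using 1 <;> ring)
      exact hx h2
    · intro h0
      have hz : ψ x = x⁻¹ := by field_simp; linear_combination h0
      rw [hz, mul_inv_cancel₀ hx] at h
      have h1 := hP.mul (hP.mul (hP.mul (hdiag _ (inv_ne_zero hx)) h) hw) hw
      have h2 := hP.mul (hP.mul hw h1) hw
      simp [hx] at h2
      have h3 := hP.inv h2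
      rw [neg_neg, neg_zero] at h3
      exact hx (hP.unip h3)
  have hprod : ∀ x₁ s, x₁ ≠ 0 → s ≠ 0 → s ^ 2 + x₁ * ψ x₁ ≠ 0 →
      (s ^ 2 + x₁ * ψ x₁ - 1) * ((x₁ * ψ x₁) ^ 2 + (x₁ * ψ x₁ - 1) * s ^ 2) = 0 ∨
      (s ^ 2 + x₁ * ψ x₁ - 1) * ((x₁ * ψ x₁) ^ 2 + (x₁ * ψ x₁ - 1) * s ^ 2) =
        1 * ψ 1 * s ^ 2 ∨
      (s ^ 2 + x₁ * ψ x₁ - 1) * ((x₁ * ψ x₁) ^ 2 + (x₁ * ψ x₁ - 1) * s ^ 2) =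
        x₀ * ψ x₀ * s ^ 2 := by
    intro x₁ s hx hs hne
    set x₂ := s ^ 2 / x₁ with hx₂
    have hx₂0 : x₂ ≠ 0 := by rw [hx₂]; positivity
    have hxx : x₁ * x₂ = s ^ 2 := by rw [hx₂]; field_simp
    have hz₂ : x₂ * ψ x₂ = x₁ * ψ x₁ := by
      have := hψs (s / x₁) x₁ (by positivity)
      rw [← this, hx₂]
      congr 2 <;> field_simp
    have hβ : x₂ + ψ x₁ ≠ 0 := by
      intro h
      apply hne
      rw [← hxx]
      linear_combination x₁ * h
    have h1 := hP.mul (hP.mul (hψ x₁) (hψ x₂)) (hdiag _ (inv_ne_zero hβ))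
    simp only [mul_zero, add_zero, zero_add, mul_one, one_mul, inv_inv] at h1
    rw [mul_inv_cancel₀ hβ] at h1
    have h2 := hψu h1
    have h3 : (s ^ 2 + x₁ * ψ x₁ - 1) * ((x₁ * ψ x₁) ^ 2 + (x₁ * ψ x₁ - 1) * s ^ 2) =
        s ^ 2 * (((x₁ * x₂ + (x₁ * ψ x₁ - 1)) * (x₂ + ψ x₁)⁻¹) *
          ψ ((x₁ * x₂ + (x₁ * ψ x₁ - 1)) * (x₂ + ψ x₁)⁻¹)) := by
      rw [h2]
      field_simp
      rw [← hxx]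
      linear_combination (-(x₁ * x₂ + x₁ * ψ x₁ - 1) * x₁ * (x₂ + ψ x₁)) * hz₂
    rw [h3]
    rcases hval ((x₁ * x₂ + (x₁ * ψ x₁ - 1)) * (x₂ + ψ x₁)⁻¹) with h | h | h <;> rw [h]
    · simp
    · right; left; ring
    · right; right; ring
  exact ⟨1 * ψ 1, x₀ * ψ x₀, hne 1 one_ne_zero, hne x₀ hx₀,
    fun s hs h => hprod 1 s one_ne_zero hs h, fun s hs h => hprod x₀ s hx₀ hs h⟩

open Polynomial in
theorem false_of_constants {F : Type*} [Field F] [Fintype F] (hF : 16 ≤ Fintype.card F) {c d : F}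
    (hc : c ≠ 1)
    (h : ∀ s, s ≠ 0 → s ^ 2 + c ≠ 0 →
        (s ^ 2 + c - 1) * (c ^ 2 + (c - 1) * s ^ 2) = 0 ∨
        (s ^ 2 + c - 1) * (c ^ 2 + (c - 1) * s ^ 2) = c * s ^ 2 ∨
        (s ^ 2 + c - 1) * (c ^ 2 + (c - 1) * s ^ 2) = d * s ^ 2) : False := by
  set f : F → F[X] := fun t =>
    (X ^ 2 + C (c - 1)) * (C (c - 1) * X ^ 2 + C (c ^ 2)) - C t * X ^ 2 with hf
  have hc1 : c - 1 ≠ 0 := sub_ne_zero.2 hc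
  have hdeg : ∀ t, (f t).natDegree = 4 := by
    intro t
    simp only [hf]
    compute_degree!
  have hf0 : ∀ t, f t ≠ 0 := fun t h0 => by simpa [h0] using hdeg t
  have hq : (X ^ 2 + C c : F[X]).natDegree = 2 := by compute_degree!
  have hq0 : (X ^ 2 + C c : F[X]) ≠ 0 := fun h0 => by simp [h0] at hq
  have hprod : f 0 * f c * f d * (X ^ 2 + C c) * X ≠ 0 :=
    mul_ne_zero (mul_ne_zero (mul_ne_zero (mul_ne_zero (hf0 _) (hf0 _)) (hf0 _)) hq0) X_ne_zero
  apply hprod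
  refine Polynomial.eq_zero_of_natDegree_lt_card_of_eval_eq_zero _ (f := id)
    Function.injective_id (fun s => ?_) ?_
  · simp only [id, hf, eval_mul, eval_sub, eval_add, eval_pow, eval_X, eval_C]
    by_cases hs : s = 0
    · simp [hs]
    by_cases hs2 : s ^ 2 + c = 0
    · simp [hs2]
    rcases h s hs hs2 with h | h | h
    · rw [show (s ^ 2 + (c - 1)) * ((c - 1) * s ^ 2 + c ^ 2) - 0 * s ^ 2 = 0 by
        linear_combination h]
      ring
    · rw [show (s ^ 2 + (c - 1)) * ((c - 1) * s ^ 2 + c ^ 2) - c * s ^ 2 = 0 by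
        linear_combination h]
      ring
    · rw [show (s ^ 2 + (c - 1)) * ((c - 1) * s ^ 2 + c ^ 2) - d * s ^ 2 = 0 by
        linear_combination h]
      ring
  · rw [natDegree_mul (by simp_all) X_ne_zero, natDegree_mul (by simp_all) hq0,
      natDegree_mul (by simp_all) (hf0 _), natDegree_mul (hf0 _) (hf0 _), hdeg, hdeg, hdeg, hq,
      natDegree_X]
    omega

theorem exists_nonsquare_representative {F : Type*} [Field F] [Fintype F]
    (hF : ringChar F ≠ 2) :
    ∃ x₀ : F, x₀ ≠ 0 ∧ ∀ x : F, x ≠ 0 → ∃ s, s ≠ 0 ∧ (x = s ^ 2 ∨ x = s ^ 2 * x₀) := by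
  classical
  obtain ⟨x₀, hx₀⟩ := FiniteField.exists_nonsquare hF
  have h0 : x₀ ≠ 0 := fun h => hx₀ (h ▸ IsSquare.zero)
  refine ⟨x₀, h0, fun x hx => ?_⟩
  by_cases h : IsSquare x
  · obtain ⟨s, rfl⟩ := h
    exact ⟨s, fun h => hx (by simp [h]), Or.inl (sq s).symm⟩
  · have h1 : quadraticChar F (x * x₀⁻¹) = 1 := by
      have e : quadraticChar F x₀ = -1 := quadraticChar_neg_one_iff_not_isSquare.2 hx₀
      have e' : quadraticChar F (x * x₀⁻¹) * quadraticChar F x₀ = quadraticChar F x := by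
        rw [← map_mul, inv_mul_cancel_right₀ h0]
      rw [e, quadraticChar_neg_one_iff_not_isSquare.2 h] at e'
      linarith
    obtain ⟨s, hs⟩ := (quadraticChar_one_iff_isSquare (mul_ne_zero hx (inv_ne_zero h0))).1 h1
    refine ⟨s, fun h => ?_, Or.inr ?_⟩
    · rw [h] at hs
      simp_all
    · rw [sq, ← hs, inv_mul_cancel_right₀ h0]

theorem false_of_constants_thirteen : ¬ ∃ c d : ZMod 13, (c ≠ 0 ∧ c ≠ 1) ∧ (d ≠ 0 ∧ d ≠ 1) ∧
      (∀ s, s ≠ 0 → s ^ 2 + c ≠ 0 →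
        (s ^ 2 + c - 1) * (c ^ 2 + (c - 1) * s ^ 2) = 0 ∨
        (s ^ 2 + c - 1) * (c ^ 2 + (c - 1) * s ^ 2) = c * s ^ 2 ∨
        (s ^ 2 + c - 1) * (c ^ 2 + (c - 1) * s ^ 2) = d * s ^ 2) ∧
      (∀ s, s ≠ 0 → s ^ 2 + d ≠ 0 →
        (s ^ 2 + d - 1) * (d ^ 2 + (d - 1) * s ^ 2) = 0 ∨
        (s ^ 2 + d - 1) * (d ^ 2 + (d - 1) * s ^ 2) = c * s ^ 2 ∨
        (s ^ 2 + d - 1) * (d ^ 2 + (d - 1) * s ^ 2) = d * s ^ 2) := by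
  decide +kernel

/-- Galois: for a prime `p ≥ 13`, no subgroup of `SL₂(𝔽_p)` acts simply transitively on the nonzero
vectors. -/
theorem prime_le_eleven {p : ℕ} [Fact p.Prime] {P : ZMod p → ZMod p → ZMod p → ZMod p → Prop}
    (hP : IsColumnRegular P) : p ≤ 11 := by
  by_contra! hp
  have hp12 : p ≠ 12 := by
    rintro rfl
    exact absurd (Fact.out : Nat.Prime 12) (by norm_num)
  obtain ⟨Q, hQ, hdiag⟩ := hP.exists_diag (by omega)
  obtain ⟨x₀, hx₀, hsq⟩ := exists_nonsquare_representative (F := ZMod p) (by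
    rw [ZMod.ringChar_zmod_n]; omega)
  have h2 : ∃ s : ZMod p, s ≠ 0 ∧ s ^ 2 ≠ 1 := by
    have key : ∀ k : ℕ, 0 < k → k < p → (k : ZMod p) ≠ 0 := fun k h0 hk h =>
      absurd (Nat.le_of_dvd h0 ((ZMod.natCast_eq_zero_iff _ _).1 h)) (by omega)
    refine ⟨2, by exact_mod_cast key 2 (by norm_num) (by omega), fun h => ?_⟩
    apply key 3 (by norm_num) (by omega)
    push_cast
    linear_combination h
  obtain ⟨c, d, hcd⟩ := hQ.exists_constants hdiag h2 x₀ hx₀ hsq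
  by_cases hp16 : 16 ≤ p
  · exact false_of_constants (by rwa [ZMod.card]) hcd.1.2 hcd.2.2.1
  · have h13 : p = 13 := by
      have := (Fact.out : p.Prime)
      interval_cases p <;> first | rfl | omega | (exfalso; revert this; norm_num)
    subst h13
    exact false_of_constants_thirteen ⟨c, d, hcd⟩

end IsColumnRegular

section OrbitClosure

open Matrix

variable {F : Type*} [CommRing F]

/-- The upper unipotent matrix with upper right entry `t`. -/
def upperUnip (t : F) : Matrix.SpecialLinearGroup (Fin 2) F :=
  ⟨!![1, t; 0, 1], by simp [det_fin_two]⟩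

/-- The lower unipotent matrix with lower left entry `t`. -/
def lowerUnip (t : F) : Matrix.SpecialLinearGroup (Fin 2) F :=
  ⟨!![1, 0; t, 1], by simp [det_fin_two]⟩

theorem upperUnip_mul (s t : F) : upperUnip s * upperUnip t = upperUnip (s + t) := by
  ext i j
  rw [Matrix.SpecialLinearGroup.coe_mul]
  fin_cases i <;> fin_cases j <;> simp [upperUnip, add_comm]

theorem lowerUnip_mul (s t : F) : lowerUnip s * lowerUnip t = lowerUnip (s + t) := by
  ext i j
  rw [Matrix.SpecialLinearGroup.coe_mul]
  fin_cases i <;> fin_cases j <;> simp [lowerUnip]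

theorem upperUnip_zero : upperUnip (0 : F) = 1 := by
  ext i j
  fin_cases i <;> fin_cases j <;> simp [upperUnip]

theorem lowerUnip_zero : lowerUnip (0 : F) = 1 := by
  ext i j
  fin_cases i <;> fin_cases j <;> simp [lowerUnip]

theorem eq_upperUnip {g : Matrix.SpecialLinearGroup (Fin 2) F} (h0 : g 0 0 = 1) (h1 : g 1 0 = 0) :
    g = upperUnip (g 0 1) := by
  have hd := g.2
  rw [det_fin_two, h0, h1] at hd
  ext i j
  fin_cases i <;> fin_cases j <;> simp_all [upperUnip]

theorem eq_lowerUnip {g : Matrix.SpecialLinearGroup (Fin 2) F} (h0 : g 1 1 = 1) (h1 : g 0 1 = 0) :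
    g = lowerUnip (g 1 0) := by
  have hd := g.2
  rw [det_fin_two, h0, h1] at hd
  ext i j
  fin_cases i <;> fin_cases j <;> simp_all [lowerUnip]

/-- The subgroup of `SL₂(F)` of elements preserving all orbits of `K` on column vectors. -/
def orbitClosure (K : Subgroup (Matrix.SpecialLinearGroup (Fin 2) F)) :
    Subgroup (Matrix.SpecialLinearGroup (Fin 2) F) where
  carrier := {g | ∀ v : Fin 2 → F, ∃ k ∈ K, k.val *ᵥ v = g.val *ᵥ v}
  one_mem' v := ⟨1, K.one_mem, rfl⟩
  mul_mem' {g h} hg hh v := by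
    obtain ⟨k, hk, e⟩ := hh v
    obtain ⟨k', hk', e'⟩ := hg (h.val *ᵥ v)
    refine ⟨k' * k, K.mul_mem hk' hk, ?_⟩
    rw [Matrix.SpecialLinearGroup.coe_mul, Matrix.SpecialLinearGroup.coe_mul, ← mulVec_mulVec, e,
      e', mulVec_mulVec]
  inv_mem' {g} hg v := by
    obtain ⟨k, hk, e⟩ := hg (g⁻¹.val *ᵥ v)
    refine ⟨k⁻¹, K.inv_mem hk, ?_⟩
    rw [mulVec_mulVec v g.val, ← Matrix.SpecialLinearGroup.coe_mul, mul_inv_cancel,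
      Matrix.SpecialLinearGroup.coe_one, one_mulVec] at e
    conv_lhs => rw [← e]
    rw [mulVec_mulVec, ← Matrix.SpecialLinearGroup.coe_mul, inv_mul_cancel,
      Matrix.SpecialLinearGroup.coe_one, one_mulVec]

theorem le_orbitClosure (K : Subgroup (Matrix.SpecialLinearGroup (Fin 2) F)) :
    K ≤ orbitClosure K :=
  fun k hk _ => ⟨k, hk, rfl⟩

theorem exists_fixing {K : Subgroup (Matrix.SpecialLinearGroup (Fin 2) F)}
    {g : Matrix.SpecialLinearGroup (Fin 2) F} (hg : g ∈ orbitClosure K) (hgK : g ∉ K)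
    (v : Fin 2 → F) :
    ∃ h ∈ orbitClosure K, h ≠ 1 ∧ h.val *ᵥ v = v := by
  obtain ⟨k, hk, e⟩ := hg v
  refine ⟨k⁻¹ * g, mul_mem (inv_mem (le_orbitClosure K hk)) hg, ?_, ?_⟩
  · intro h
    rw [inv_mul_eq_one] at h
    exact hgK (h ▸ hk)
  · rw [Matrix.SpecialLinearGroup.coe_mul, ← mulVec_mulVec, ← e, mulVec_mulVec,
      ← Matrix.SpecialLinearGroup.coe_mul, inv_mul_cancel, Matrix.SpecialLinearGroup.coe_one,
      one_mulVec]

theorem mem_of_hom_mem {p : ℕ} [Fact p.Prime] {G : Type*} [Group G] (L : Subgroup G)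
    (f : ZMod p → G) (h0 : f 0 = 1) (hf : ∀ s t, f s * f t = f (s + t)) {t : ZMod p} (ht : t ≠ 0)
    (h : f t ∈ L) (s : ZMod p) : f s ∈ L := by
  have key : ∀ n : ℕ, f (n * t) ∈ L := by
    intro n
    induction n with
    | zero => simp [h0]
    | succ n ih =>
      have := L.mul_mem ih h
      rw [hf] at this
      convert this using 2
      push_cast
      ring
  have := key (s / t).val
  rwa [ZMod.natCast_zmod_val, div_mul_cancel₀ _ ht] at this

theorem exists_mem_column {p : ℕ} [Fact p.Prime]
    (L : Subgroup (Matrix.SpecialLinearGroup (Fin 2) (ZMod p)))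
    (hu : ∀ s, upperUnip s ∈ L) (hl : ∀ s, lowerUnip s ∈ L) (a c : ZMod p)
    (hac : ¬ (a = 0 ∧ c = 0)) : ∃ g ∈ L, g 0 0 = a ∧ g 1 0 = c := by
  have key : ∀ a c : ZMod p, c ≠ 0 → ∃ g ∈ L, g 0 0 = a ∧ g 1 0 = c := by
    intro a c hc
    refine ⟨upperUnip ((a - 1) / c) * lowerUnip c, mul_mem (hu _) (hl _), ?_, ?_⟩
    · rw [Matrix.SpecialLinearGroup.coe_mul]
      simp [upperUnip, lowerUnip, hc]
    · rw [Matrix.SpecialLinearGroup.coe_mul]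
      simp [upperUnip, lowerUnip]
  by_cases hc : c = 0
  · have ha : a ≠ 0 := fun ha => hac ⟨ha, hc⟩
    obtain ⟨g, hg, e0, e1⟩ := key a 1 one_ne_zero
    refine ⟨lowerUnip (-a⁻¹) * g, mul_mem (hl _) hg, ?_, ?_⟩
    · rw [Matrix.SpecialLinearGroup.coe_mul]
      simp [lowerUnip, mul_apply, e0]
    · rw [Matrix.SpecialLinearGroup.coe_mul]
      simp [lowerUnip, mul_apply, e0, e1, ha, hc]
  · exact key a c hc

end OrbitClosure

section ColumnTransitive

open Matrix

variable {F : Type*} [Field F] {p : ℕ} [Fact p.Prime]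

theorem eq_top_of_columns {K : Subgroup (Matrix.SpecialLinearGroup (Fin 2) F)}
    (hu : ∀ s, upperUnip s ∈ K)
    (hK : ∀ a c : F, ¬ (a = 0 ∧ c = 0) → ∃ g ∈ K, g 0 0 = a ∧ g 1 0 = c) : K = ⊤ := by
  rw [eq_top_iff]
  rintro g -
  have hd := g.2
  rw [det_fin_two] at hd
  obtain ⟨k, hk, e0, e1⟩ := hK (g 0 0) (g 1 0) (by
    rintro ⟨h1, h2⟩
    rw [h1, h2] at hd
    simp at hd)
  have h : k⁻¹ * g ∈ K := by
    rw [eq_upperUnip (g := k⁻¹ * g)]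
    · exact hu _
    · rw [Matrix.SpecialLinearGroup.coe_mul, Matrix.SpecialLinearGroup.coe_inv, adjugate_fin_two]
      have hd' := k.2
      rw [det_fin_two] at hd'
      simp [mul_apply, ← e0, ← e1]
      linear_combination hd'
    · rw [Matrix.SpecialLinearGroup.coe_mul, Matrix.SpecialLinearGroup.coe_inv, adjugate_fin_two]
      simp [mul_apply, ← e0, ← e1]
      ring
  simpa using K.mul_mem hk h

theorem columns_of_orbitClosure_ne {K : Subgroup (Matrix.SpecialLinearGroup (Fin 2) (ZMod p))}
    {g : Matrix.SpecialLinearGroup (Fin 2) (ZMod p)} (hg : g ∈ orbitClosure K) (hgK : g ∉ K)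
    (a c : ZMod p) (hac : ¬ (a = 0 ∧ c = 0)) : ∃ k ∈ K, k 0 0 = a ∧ k 1 0 = c := by
  have hu : ∀ s, upperUnip s ∈ orbitClosure K := by
    obtain ⟨h, hh, h1, e⟩ := exists_fixing hg hgK ![1, 0]
    have e' := eq_upperUnip (g := h) (by simpa [mulVec, dotProduct] using congrFun e 0)
      (by simpa [mulVec, dotProduct] using congrFun e 1)
    rw [e'] at hh
    exact mem_of_hom_mem _ _ upperUnip_zero upperUnip_mul
      (fun h0 => h1 (by rw [e', h0, upperUnip_zero])) hh
  have hl : ∀ s, lowerUnip s ∈ orbitClosure K := by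
    obtain ⟨h, hh, h1, e⟩ := exists_fixing hg hgK ![0, 1]
    have e' := eq_lowerUnip (g := h) (by simpa [mulVec, dotProduct] using congrFun e 1)
      (by simpa [mulVec, dotProduct] using congrFun e 0)
    rw [e'] at hh
    exact mem_of_hom_mem _ _ lowerUnip_zero lowerUnip_mul
      (fun h0 => h1 (by rw [e', h0, lowerUnip_zero])) hh
  obtain ⟨l, hl, e0, e1⟩ := exists_mem_column _ hu hl a c hac
  obtain ⟨k, hk, e⟩ := hl ![1, 0]
  refine ⟨k, hk, ?_, ?_⟩
  · simpa [mulVec, dotProduct, e0] using congrFun e 0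
  · simpa [mulVec, dotProduct, e1] using congrFun e 1

theorem isColumnRegular_of_columns {K : Subgroup (Matrix.SpecialLinearGroup (Fin 2) F)}
    (hK : ∀ a c : F, ¬ (a = 0 ∧ c = 0) → ∃ g ∈ K, g 0 0 = a ∧ g 1 0 = c)
    (hu : ∀ t : F, upperUnip t ∈ K → t = 0) :
    IsColumnRegular fun a b c d => ∃ k ∈ K, k.val = !![a, b; c, d] where
  mul := by
    rintro _ _ _ _ _ _ _ _ ⟨k, hk, e⟩ ⟨k', hk', e'⟩
    exact ⟨k * k', mul_mem hk hk', by rw [Matrix.SpecialLinearGroup.coe_mul, e, e', mul_fin_two]⟩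
  inv := by
    rintro _ _ _ _ ⟨k, hk, e⟩
    exact ⟨k⁻¹, inv_mem hk, by rw [Matrix.SpecialLinearGroup.coe_inv, e, adjugate_fin_two_of]⟩
  det := by
    rintro _ _ _ _ ⟨k, hk, e⟩
    rw [← det_fin_two_of, ← e]
    exact k.2
  trans a c h := by
    obtain ⟨k, hk, rfl, rfl⟩ := hK a c h
    exact ⟨_, _, k, hk, Matrix.eta_fin_two k.val⟩
  unip := by
    rintro t ⟨k, hk, e⟩
    exact hu t (by rwa [← show k = upperUnip t from Subtype.ext e])

theorem index_eq_card_of_columns {K : Subgroup (Matrix.SpecialLinearGroup (Fin 2) F)}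
    (hK : ∀ a c : F, ¬ (a = 0 ∧ c = 0) → ∃ g ∈ K, g 0 0 = a ∧ g 1 0 = c)
    (hu : ∀ t : F, upperUnip t ∈ K → t = 0) : K.index = Nat.card F := by
  have hinv : ∀ t : F, (upperUnip t)⁻¹ = upperUnip (-t) := fun t =>
    inv_eq_of_mul_eq_one_right (by rw [upperUnip_mul, add_neg_cancel, upperUnip_zero])
  symm
  refine Nat.card_congr (Equiv.ofBijective
    (fun t => (upperUnip t : Matrix.SpecialLinearGroup (Fin 2) F ⧸ K))
    ⟨fun s t h => ?_, fun q => ?_⟩)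
  · rw [QuotientGroup.eq, hinv, upperUnip_mul] at h
    linear_combination -(hu _ h)
  · obtain ⟨g, rfl⟩ := QuotientGroup.mk_surjective q
    have hd := (g⁻¹).2
    rw [det_fin_two] at hd
    obtain ⟨k, hk, e0, e1⟩ := hK (g⁻¹ 0 0) (g⁻¹ 1 0) (by
      rintro ⟨h1, h2⟩
      rw [h1, h2] at hd
      simp at hd)
    have hgk : ∀ i, (g * k) i 0 = (1 : Matrix (Fin 2) (Fin 2) F) i 0 := by
      intro i
      rw [← Matrix.SpecialLinearGroup.coe_one, ← mul_inv_cancel g,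
        Matrix.SpecialLinearGroup.coe_mul, Matrix.SpecialLinearGroup.coe_mul, mul_apply, mul_apply,
        Fin.sum_univ_two, Fin.sum_univ_two,
        e0, e1]
    have e := eq_upperUnip (g := g * k) (by simpa using hgk 0) (by simpa using hgk 1)
    refine ⟨(g * k).val 0 1, ?_⟩
    simp only
    rw [← e, eq_comm, QuotientGroup.eq]
    simpa using hk

/-- The reduction `SL₂(ℤ) → SL₂(ℤ/p)` is surjective. -/
theorem reduction_surjective : Function.Surjective
    (Matrix.SpecialLinearGroup.map (n := Fin 2) (Int.castRingHom (ZMod p))) := by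
  rw [← MonoidHom.range_eq_top]
  have hu : ∀ s : ZMod p, upperUnip s ∈
      (Matrix.SpecialLinearGroup.map (n := Fin 2) (Int.castRingHom (ZMod p))).range := by
    intro s
    refine ⟨⟨!![1, (s.val : ℤ); 0, 1], by simp [det_fin_two]⟩, ?_⟩
    ext i j
    change Int.castRingHom (ZMod p) (!![1, (s.val : ℤ); 0, 1] i j) = (upperUnip s).val i j
    fin_cases i <;> fin_cases j <;> simp [upperUnip]
  have hl : ∀ s : ZMod p, lowerUnip s ∈
      (Matrix.SpecialLinearGroup.map (n := Fin 2) (Int.castRingHom (ZMod p))).range := by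
    intro s
    refine ⟨⟨!![1, 0; (s.val : ℤ), 1], by simp [det_fin_two]⟩, ?_⟩
    ext i j
    change Int.castRingHom (ZMod p) (!![1, 0; (s.val : ℤ), 1] i j) = (lowerUnip s).val i j
    fin_cases i <;> fin_cases j <;> simp [lowerUnip]
  exact eq_top_of_columns hu (exists_mem_column _ hu hl)

/-- A proper subgroup of `SL₂(𝔽_p)` is determined by its orbits on vectors, unless
`p ∈ {2, 3, 5, 7, 11}` and its index is `p`. -/
theorem orbitClosure_eq_self {K : Subgroup (Matrix.SpecialLinearGroup (Fin 2) (ZMod p))}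
    (hnot : ¬ (p ∈ ({2, 3, 5, 7, 11} : Set ℕ) ∧ K.index = p)) : orbitClosure K = K := by
  refine le_antisymm (fun g hg => ?_) (le_orbitClosure K)
  by_contra hgK
  have hcol := columns_of_orbitClosure_ne hg hgK
  by_cases hu : ∀ t : ZMod p, upperUnip t ∈ K → t = 0
  · have h11 := (isColumnRegular_of_columns hcol hu).prime_le_eleven
    refine hnot ⟨?_, by rw [index_eq_card_of_columns hcol hu, Nat.card_zmod]⟩
    have := (Fact.out : p.Prime)
    interval_cases p <;> revert this <;> norm_num
  · push Not at hu
    obtain ⟨t, ht, ht0⟩ := hu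
    have := eq_top_of_columns
      (mem_of_hom_mem K _ upperUnip_zero upperUnip_mul ht0 ht) hcol
    exact hgK (this ▸ Subgroup.mem_top g)

end ColumnTransitive

section FoxCalculus

open Matrix

/-- The image of an element of `F₂` in the abelianization `ℤ²`. -/
def abVec (w : F2) : Fin 2 → ℤ := fun i => (expSum i w).toAdd

theorem abVec_one : abVec 1 = 0 := by
  ext i
  simp [abVec]

theorem abVec_mul (v w : F2) : abVec (v * w) = abVec v + abVec w := by
  ext i
  simp [abVec]

theorem abVec_inv (w : F2) : abVec w⁻¹ = -abVec w := by
  ext i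
  simp [abVec]

theorem abVec_pow (w : F2) (n : ℕ) : abVec (w ^ n) = n • abVec w := by
  ext i
  simp [abVec]

theorem abVec_of (i : Fin 2) : abVec (FreeGroup.of i) = Pi.single i 1 := by
  ext j
  simp [abVec, expSum, Pi.single_apply, eq_comm]

theorem abVec_conj (g w : F2) : abVec (g * w * g⁻¹) = abVec w := by
  rw [abVec_mul, abVec_mul, abVec_inv]
  abel

theorem abVec_apply_equiv (γ : F2 ≃* F2) (w : F2) : abVec (γ w) = autMat γ *ᵥ abVec w := by
  have hof : ∀ i, abVec (γ (FreeGroup.of i)) = autMat γ *ᵥ abVec (FreeGroup.of i) := by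
    intro i
    rw [abVec_of, mulVec_single_one]
    rfl
  induction w using FreeGroup.induction_on with
  | C1 => rw [map_one, abVec_one, mulVec_zero]
  | of i => exact hof i
  | inv_of i _ => rw [map_inv, abVec_inv, abVec_inv, hof, mulVec_neg]
  | mul v w hv hw => rw [map_mul, abVec_mul, abVec_mul, hv, hw, mulVec_add]

theorem autMat_mul (γ δ : F2 ≃* F2) : autMat (γ * δ) = autMat γ * autMat δ := by
  ext i j
  have h := congrFun (abVec_apply_equiv γ (δ (FreeGroup.of j))) i
  rw [abVec_apply_equiv δ, abVec_of, mulVec_mulVec, mulVec_single_one] at h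
  exact h

theorem autMat_one : autMat 1 = 1 := by
  ext i j
  have h := congrFun (abVec_of j) i
  rw [Pi.single_apply] at h
  rw [one_apply]
  exact h

/-- The commutator `[x, y]`. -/
def commGen : F2 := xg * yg * xg⁻¹ * yg⁻¹

theorem abVec_commGen : abVec commGen = 0 := by
  simp only [commGen, abVec_mul, abVec_inv]
  abel

theorem mk_eq_zpow_mul_zpow (w : F2) :
    (w : F2 ⧸ Subgroup.normalClosure {commGen}) =
      (xg : F2 ⧸ Subgroup.normalClosure {commGen}) ^ abVec w 0 * (yg : F2 ⧸ _) ^ abVec w 1 := by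
  have hc : Commute (xg : F2 ⧸ Subgroup.normalClosure {commGen}) yg := by
    have h : ((commGen : F2) : F2 ⧸ Subgroup.normalClosure {commGen}) = 1 :=
      (QuotientGroup.eq_one_iff _).2 (Subgroup.subset_normalClosure rfl)
    rw [commGen, QuotientGroup.mk_mul, QuotientGroup.mk_mul, QuotientGroup.mk_mul,
      QuotientGroup.mk_inv, QuotientGroup.mk_inv, mul_inv_eq_one, mul_inv_eq_iff_eq_mul] at h
    exact h
  induction w using FreeGroup.induction_on with
  | C1 => simp [abVec_one]
  | of i => fin_cases i <;> simp [abVec_of, xg, yg]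
  | inv_of i _ => fin_cases i <;> simp [abVec_of, abVec_inv, xg, yg]
  | mul v w hv hw =>
    rw [QuotientGroup.mk_mul, hv, hw, abVec_mul, Pi.add_apply, Pi.add_apply, _root_.zpow_add,
      _root_.zpow_add]
    simp only [mul_assoc]
    congr 1
    simp only [← mul_assoc]
    congr 1
    exact ((hc.zpow_zpow _ _).symm).eq

theorem mem_normalClosure_of_abVec_eq_zero {w : F2} (hw : abVec w = 0) :
    w ∈ Subgroup.normalClosure {commGen} := by
  rw [← QuotientGroup.eq_one_iff, mk_eq_zpow_mul_zpow, hw]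
  simp

/-- The group ring of the abelianization `ℤ²` of `F₂`. -/
abbrev LaurentRing := AddMonoidAlgebra ℤ (Fin 2 → ℤ)

/-- The monomial in `ℤ[ℤ²]` attached to an element of `F₂`. -/
noncomputable def monom (w : F2) : LaurentRing := AddMonoidAlgebra.single (abVec w) 1

theorem monom_mul (v w : F2) : monom (v * w) = monom v * monom w := by
  rw [monom, abVec_mul, monom, monom, AddMonoidAlgebra.single_mul_single, one_mul]

theorem monom_of_abVec_eq_zero {w : F2} (hw : abVec w = 0) : monom w = 1 := by
  rw [monom, hw, AddMonoidAlgebra.one_def]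

theorem monom_one : monom 1 = 1 := monom_of_abVec_eq_zero abVec_one

theorem monom_inv_mul (w : F2) : monom w⁻¹ * monom w = 1 := by
  rw [← monom_mul, inv_mul_cancel, monom_one]

theorem monom_mul_inv (w : F2) : monom w * monom w⁻¹ = 1 := by
  rw [← monom_mul, mul_inv_cancel, monom_one]

/-- The affine action of `F₂` on `ℤ[ℤ²]` in which `x` acts by `s ↦ X s + 1` and `y` by `s ↦ Y s`. -/
noncomputable def foxAction : F2 →* Equiv.Perm LaurentRing :=
  FreeGroup.lift fun i =>
    { toFun := fun s => monom (FreeGroup.of i) * s + if i = 0 then 1 else 0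
      invFun := fun s => monom (FreeGroup.of i)⁻¹ * (s - if i = 0 then 1 else 0)
      left_inv := fun s => by
        beta_reduce
        rw [add_sub_cancel_right, ← mul_assoc, monom_inv_mul, one_mul]
      right_inv := fun s => by
        beta_reduce
        rw [← mul_assoc, monom_mul_inv, one_mul, sub_add_cancel] }

/-- The abelianized Fox derivative with respect to `x`. -/
noncomputable def foxDeriv (w : F2) : LaurentRing := foxAction w 0

theorem foxAction_apply (w : F2) (s : LaurentRing) :
    foxAction w s = monom w * s + foxDeriv w := by
  induction w using FreeGroup.induction_on generalizing s with
  | C1 => simp [foxDeriv, monom_one]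
  | of i => simp [foxDeriv, foxAction]
  | inv_of i ih =>
    have h := ih (foxAction (FreeGroup.of i)⁻¹ s)
    have h0 := ih (foxAction (FreeGroup.of i)⁻¹ 0)
    rw [← Equiv.Perm.mul_apply, ← map_mul, mul_inv_cancel, map_one, Equiv.Perm.one_apply] at h h0
    rw [foxDeriv]
    linear_combination (monom (FreeGroup.of i)⁻¹) * (h0 - h) -
      (foxAction (FreeGroup.of i)⁻¹ s - foxAction (FreeGroup.of i)⁻¹ 0) *
        monom_inv_mul (FreeGroup.of i)
  | mul v w hv hw =>
    rw [foxDeriv, map_mul, Equiv.Perm.mul_apply, Equiv.Perm.mul_apply, hw, hv, hv, hw, monom_mul]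
    ring

theorem foxDeriv_mul (v w : F2) : foxDeriv (v * w) = foxDeriv v + monom v * foxDeriv w := by
  rw [foxDeriv, map_mul, Equiv.Perm.mul_apply, foxAction_apply, add_comm]
  rfl

theorem foxDeriv_one : foxDeriv 1 = 0 := by
  rw [foxDeriv, map_one, Equiv.Perm.one_apply]

theorem foxDeriv_inv (w : F2) : foxDeriv w⁻¹ = -(monom w⁻¹ * foxDeriv w) := by
  have h := foxDeriv_mul w⁻¹ w
  rw [inv_mul_cancel, foxDeriv_one] at h
  linear_combination -h

theorem foxDeriv_conj {w : F2} (hw : abVec w = 0) (g : F2) :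
    foxDeriv (g * w * g⁻¹) = monom g * foxDeriv w := by
  rw [foxDeriv_mul, foxDeriv_mul, foxDeriv_inv, monom_mul, monom_of_abVec_eq_zero hw]
  linear_combination -foxDeriv g * monom_mul_inv g

theorem foxDeriv_commGen : foxDeriv commGen = 1 - monom yg := by
  have hx : foxDeriv xg = 1 := by simp [foxDeriv, foxAction, xg]
  have hy : foxDeriv yg = 0 := by simp [foxDeriv, foxAction, yg]
  rw [commGen, foxDeriv_mul, foxDeriv_mul, foxDeriv_mul, foxDeriv_inv, foxDeriv_inv, hx, hy,
    monom_mul]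
  linear_combination -monom yg * monom_mul_inv xg

/-- The ring endomorphism of `ℤ[ℤ²]` induced by an automorphism of `F₂`. -/
noncomputable def pushRing (γ : F2 ≃* F2) : LaurentRing →+* LaurentRing :=
  AddMonoidAlgebra.mapDomainRingHom ℤ (autMat γ).mulVecLin.toAddMonoidHom

theorem pushRing_monom (γ : F2 ≃* F2) (w : F2) : pushRing γ (monom w) = monom (γ w) := by
  rw [pushRing, AddMonoidAlgebra.mapDomainRingHom_apply, monom, AddMonoidAlgebra.mapDomain_single,
    monom, abVec_apply_equiv]
  rfl

theorem exists_foxDeriv_eq (γ : F2 ≃* F2) {w : F2} (hw : abVec w = 0) :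
    ∃ q, foxDeriv w = q * (1 - monom yg) ∧
      foxDeriv (γ w) = pushRing γ q * foxDeriv (γ commGen) := by
  have hγ : ∀ {w : F2}, abVec w = 0 → abVec (γ w) = 0 := fun h => by
    rw [abVec_apply_equiv, h, mulVec_zero]
  have key : ∀ w ∈ Subgroup.normalClosure {commGen}, abVec w = 0 ∧
      ∃ q, foxDeriv w = q * (1 - monom yg) ∧
        foxDeriv (γ w) = pushRing γ q * foxDeriv (γ commGen) := by
    intro w hw
    induction hw using Subgroup.closure_induction with
    | mem w hw =>
      obtain ⟨a, rfl, hc⟩ := Group.mem_conjugatesOfSet_iff.1 hw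
      obtain ⟨g, rfl⟩ := isConj_iff.1 hc
      refine ⟨by rw [abVec_conj, abVec_commGen], monom g, ?_, ?_⟩
      · rw [foxDeriv_conj abVec_commGen, foxDeriv_commGen]
      · rw [map_mul, map_mul, map_inv, foxDeriv_conj (hγ abVec_commGen), pushRing_monom]
    | one => exact ⟨abVec_one, 0, by simp [foxDeriv_one], by simp [foxDeriv_one]⟩
    | mul v w _ _ hv hw =>
      obtain ⟨hv, q, h1, h2⟩ := hv
      obtain ⟨hw, r, h3, h4⟩ := hw
      refine ⟨by rw [abVec_mul, hv, hw, add_zero], q + r, ?_, ?_⟩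
      · rw [foxDeriv_mul, monom_of_abVec_eq_zero hv, h1, h3]
        ring
      · rw [map_mul, foxDeriv_mul, monom_of_abVec_eq_zero (hγ hv), h2, h4, map_add]
        ring
    | inv w _ hw =>
      obtain ⟨hw, q, h1, h2⟩ := hw
      have hw' : abVec w⁻¹ = 0 := by rw [abVec_inv, hw, neg_zero]
      refine ⟨hw', -q, ?_, ?_⟩
      · rw [foxDeriv_inv, monom_of_abVec_eq_zero hw', h1]
        ring
      · rw [map_inv, foxDeriv_inv, ← map_inv, monom_of_abVec_eq_zero (hγ hw'), h2, map_neg]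
        ring
  exact (key w (mem_normalClosure_of_abVec_eq_zero hw)).2

theorem monom_yg_ne_one : (1 : LaurentRing) - monom yg ≠ 0 := by
  rw [sub_ne_zero, AddMonoidAlgebra.one_def, monom, yg, abVec_of]
  intro h
  have h := congrArg (fun f => f.coeff 0) h
  simp at h

theorem exists_eq_single_of_isUnit {A : Type*} [AddMonoid A] [TwoUniqueSums A]
    {f : AddMonoidAlgebra ℤ A} (hf : IsUnit f) :
    ∃ a, ∃ ε : ℤ, IsUnit ε ∧ f = AddMonoidAlgebra.single a ε := by
  obtain ⟨g, hg⟩ := hf.exists_right_inv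
  have hf0 : f ≠ 0 := hf.ne_zero
  have hg0 : g ≠ 0 := right_ne_zero_of_mul_eq_one hg
  have hsum : ∀ a ∈ f.coeff.support, ∀ b ∈ g.coeff.support,
      UniqueAdd f.coeff.support g.coeff.support a b → a + b = 0 := by
    intro a ha b hb hab
    have h := AddMonoidAlgebra.coeff_mul_add_of_uniqueAdd hab
    by_contra h0
    rw [hg, AddMonoidAlgebra.one_def, AddMonoidAlgebra.coeff_single,
      Finsupp.single_eq_of_ne h0, eq_comm] at h
    exact mul_ne_zero (Finsupp.mem_support_iff.1 ha) (Finsupp.mem_support_iff.1 hb) h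
  have hcard : ¬ 1 < f.coeff.support.card * g.coeff.support.card := by
    intro hlt
    obtain ⟨⟨a, b⟩, h1, ⟨a', b'⟩, h2, hne, hu, hu'⟩ := TwoUniqueSums.uniqueAdd_of_one_lt_card hlt
    rw [Finset.mem_product] at h1 h2
    obtain ⟨h3, h4⟩ := hu h2.1 h2.2
      ((hsum _ h2.1 _ h2.2 hu').trans (hsum _ h1.1 _ h1.2 hu).symm)
    exact hne (Prod.ext h3.symm h4.symm)
  have hfc : 0 < f.coeff.support.card :=
    Finset.card_pos.2 (Finsupp.support_nonempty_iff.2 (by simpa using hf0))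
  have hgc : 0 < g.coeff.support.card :=
    Finset.card_pos.2 (Finsupp.support_nonempty_iff.2 (by simpa using hg0))
  obtain ⟨a, -, ha⟩ := Finsupp.card_support_eq_one.1 (show f.coeff.support.card = 1 by nlinarith)
  obtain ⟨b, -, hb⟩ := Finsupp.card_support_eq_one.1 (show g.coeff.support.card = 1 by nlinarith)
  replace ha : f = AddMonoidAlgebra.single a (f.coeff a) := AddMonoidAlgebra.coeff_injective ha
  replace hb : g = AddMonoidAlgebra.single b (g.coeff b) := AddMonoidAlgebra.coeff_injective hb
  refine ⟨a, f.coeff a, ?_, ha⟩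
  rw [ha, hb, AddMonoidAlgebra.single_mul_single, AddMonoidAlgebra.one_def] at hg
  have h := congrArg AddMonoidAlgebra.coeff hg
  rw [AddMonoidAlgebra.coeff_single, AddMonoidAlgebra.coeff_single,
    Finsupp.single_eq_single_iff] at h
  rcases h with ⟨-, h⟩ | ⟨-, h⟩
  · exact IsUnit.of_mul_eq_one _ h
  · exact absurd h one_ne_zero

/-- Every automorphism of `F₂` multiplies the derivative of `[x, y]` by a trivial unit. -/
theorem exists_foxDeriv_apply_commGen (γ : F2 ≃* F2) : ∃ a, ∃ ε : ℤ, IsUnit ε ∧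
    foxDeriv (γ commGen) = AddMonoidAlgebra.single a ε * (1 - monom yg) := by
  have h0 : abVec (γ commGen) = 0 := by rw [abVec_apply_equiv, abVec_commGen, mulVec_zero]
  have h1 : abVec (γ.symm commGen) = 0 := by rw [abVec_apply_equiv, abVec_commGen, mulVec_zero]
  obtain ⟨q, hq, -⟩ := exists_foxDeriv_eq γ h0
  obtain ⟨r, -, hr⟩ := exists_foxDeriv_eq γ h1
  rw [MulEquiv.apply_symm_apply, foxDeriv_commGen, hq] at hr
  have hu : pushRing γ r * q = 1 := mul_right_cancel₀ monom_yg_ne_one (by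
    rw [one_mul, mul_assoc, ← hr])
  obtain ⟨a, ε, hε, rfl⟩ := exists_eq_single_of_isUnit (IsUnit.of_mul_eq_one_right _ hu)
  exact ⟨a, ε, hε, hq⟩

end FoxCalculus

section ColoringSubgroup

open Matrix

variable {Q : Type*} [AddCommGroup Q] (π : (Fin 2 → ℤ) →+ Q) (μ : Q → ℕ) (M : ℕ)

/-- The homomorphism from `F₂` to a quotient of its abelianization. -/
def abHom : F2 →* Multiplicative Q where
  toFun w := Multiplicative.ofAdd (π (abVec w))
  map_one' := by rw [abVec_one, map_zero, ofAdd_zero]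
  map_mul' v w := by rw [abVec_mul, map_add, ofAdd_add]

theorem mem_ker_abHom {w : F2} : w ∈ (abHom π).ker ↔ π (abVec w) = 0 := Iff.rfl

/-- The subgroup of `F₂` attached to a quotient `Q` of `ℤ²`, with `H` the kernel of `F₂ → Q`, and
to a coloring `μ` of `Q`: it is generated by the `M`-th powers of elements of `H`, the commutators
of elements of `H`, and the conjugates `g [x, y] ^ μ(q) g⁻¹` where `q ∈ Q` is the image of `g`. -/
def coloringSubgroup : Subgroup F2 :=
  Subgroup.closure ({w | ∃ h ∈ (abHom π).ker, w = h ^ M} ∪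
    {w | ∃ h ∈ (abHom π).ker, ∃ k ∈ (abHom π).ker, w = h * k * h⁻¹ * k⁻¹} ∪
    {w | ∃ g : F2, w = g * commGen ^ μ (π (abVec g)) * g⁻¹})

variable {π μ M}

theorem conj_mem_coloringSubgroup (g : F2) :
    g * commGen ^ μ (π (abVec g)) * g⁻¹ ∈ coloringSubgroup π μ M :=
  Subgroup.subset_closure (Or.inr ⟨g, rfl⟩)

theorem pow_mem_coloringSubgroup {h : F2} (hh : h ∈ (abHom π).ker) :
    h ^ M ∈ coloringSubgroup π μ M :=
  Subgroup.subset_closure (Or.inl (Or.inl ⟨h, hh, rfl⟩))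

theorem commutator_mem_coloringSubgroup {h k : F2} (hh : h ∈ (abHom π).ker)
    (hk : k ∈ (abHom π).ker) : h * k * h⁻¹ * k⁻¹ ∈ coloringSubgroup π μ M :=
  Subgroup.subset_closure (Or.inl (Or.inr ⟨h, hh, k, hk, rfl⟩))

theorem finiteIndex_coloringSubgroup [Finite Q] (hM : M ≠ 0) :
    (coloringSubgroup π μ M).FiniteIndex := by
  let H := (abHom π).ker
  let f : H →* Abelianization H := Abelianization.of
  have hf : Function.Surjective f := QuotientGroup.mk_surjective
  have hfg : Group.FG H := Subgroup.fg_of_index_ne_zero H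
  have hfg' : Group.FG (Abelianization H) :=
    Group.fg_of_surjective (f := f) hf
  have hfin := Subgroup.finiteIndex_range_powMonoidHom_of_fg (Abelianization H) hM
  have hcomm : commutator H ≤ (coloringSubgroup π μ M).subgroupOf H := by
    rw [commutator_def, Subgroup.commutator_le]
    rintro ⟨h, hh⟩ - ⟨k, hk⟩ -
    exact commutator_mem_coloringSubgroup hh hk
  have hle : (powMonoidHom (α := Abelianization H) M).range.comap f ≤
      (coloringSubgroup π μ M).subgroupOf H := by
    rintro h ⟨q, hq⟩
    obtain ⟨k, rfl⟩ := hf q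
    have h1 : (k ^ M)⁻¹ * h ∈ commutator H := by
      rw [← Abelianization.ker_of, MonoidHom.mem_ker, map_mul, map_inv, map_pow]
      rw [inv_mul_eq_one]
      exact hq
    have h2 : k ^ M ∈ (coloringSubgroup π μ M).subgroupOf H := by
      rw [Subgroup.mem_subgroupOf]
      exact pow_mem_coloringSubgroup k.2
    simpa using mul_mem h2 (hcomm h1)
  have hfin' : ((powMonoidHom (α := Abelianization H) M).range.comap f).FiniteIndex :=
    ⟨by rw [Subgroup.index_comap_of_surjective _ hf]; exact hfin.index_ne_zero⟩
  have h1 : ((coloringSubgroup π μ M).subgroupOf H).FiniteIndex := Subgroup.finiteIndex_of_le hle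
  have h2 : H.FiniteIndex := inferInstance
  rw [Subgroup.finiteIndex_iff] at h1 h2 ⊢
  have := Subgroup.relIndex_ne_zero_trans (H := coloringSubgroup π μ M) (K := H) (L := ⊤) h1
    (by rwa [Subgroup.relIndex_top_right])
  rwa [Subgroup.relIndex_top_right] at this

theorem map_coloringSubgroup_le {γ : F2 ≃* F2} (hc : γ commGen = commGen)
    (hπ : ∀ v, π v = 0 → π (autMat γ *ᵥ v) = 0) (hμ : ∀ v, μ (π (autMat γ *ᵥ v)) = μ (π v)) :
    (coloringSubgroup π μ M).map γ.toMonoidHom ≤ coloringSubgroup π μ M := by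
  have hH : ∀ h ∈ (abHom π).ker, γ h ∈ (abHom π).ker := fun h hh => by
    rw [mem_ker_abHom, abVec_apply_equiv]
    exact hπ _ hh
  rw [Subgroup.map_le_iff_le_comap]
  refine (Subgroup.closure_le _).2 ?_
  rintro w ((⟨h, hh, rfl⟩ | ⟨h, hh, k, hk, rfl⟩) | ⟨g, rfl⟩)
  · change γ (h ^ M) ∈ coloringSubgroup π μ M
    rw [map_pow]
    exact pow_mem_coloringSubgroup (hH h hh)
  · change γ (h * k * h⁻¹ * k⁻¹) ∈ coloringSubgroup π μ M
    rw [map_mul, map_mul, map_mul, map_inv, map_inv]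
    exact commutator_mem_coloringSubgroup (hH h hh) (hH k hk)
  · change γ (g * commGen ^ μ (π (abVec g)) * g⁻¹) ∈ coloringSubgroup π μ M
    rw [map_mul, map_mul, map_pow, map_inv, hc, ← hμ, ← abVec_apply_equiv]
    exact conj_mem_coloringSubgroup _

variable (π) in
/-- The Fox derivative with coefficients reduced to the group ring of `Q`. -/
noncomputable def redDeriv (w : F2) : AddMonoidAlgebra ℤ Q :=
  AddMonoidAlgebra.mapDomainRingHom ℤ π (foxDeriv w)

theorem mapDomain_monom (w : F2) : AddMonoidAlgebra.mapDomainRingHom ℤ π (monom w) =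
    AddMonoidAlgebra.single (π (abVec w)) 1 := by
  rw [monom, AddMonoidAlgebra.mapDomainRingHom_apply, AddMonoidAlgebra.mapDomain_single]

theorem redDeriv_mul {v : F2} (hv : v ∈ (abHom π).ker) (w : F2) :
    redDeriv π (v * w) = redDeriv π v + redDeriv π w := by
  rw [mem_ker_abHom] at hv
  rw [redDeriv, foxDeriv_mul, map_add, map_mul, mapDomain_monom, hv, ← AddMonoidAlgebra.one_def,
    one_mul]
  rfl

theorem redDeriv_one : redDeriv π 1 = 0 := by
  rw [redDeriv, foxDeriv_one, map_zero]

theorem redDeriv_inv {v : F2} (hv : v ∈ (abHom π).ker) : redDeriv π v⁻¹ = -redDeriv π v := by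
  have h := redDeriv_mul hv v⁻¹
  rw [mul_inv_cancel, redDeriv_one] at h
  linear_combination -h

theorem redDeriv_pow {v : F2} (hv : v ∈ (abHom π).ker) (n : ℕ) :
    redDeriv π (v ^ n) = n * redDeriv π v := by
  induction n with
  | zero => rw [pow_zero, redDeriv_one, Nat.cast_zero, zero_mul]
  | succ n ih =>
    rw [pow_succ, redDeriv_mul (pow_mem hv n), ih]
    push_cast
    ring

theorem mapDomain_one_sub_monom_yg :
    AddMonoidAlgebra.mapDomainRingHom ℤ π (1 - monom yg) =
      1 - AddMonoidAlgebra.single (π (abVec yg)) 1 := by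
  rw [map_sub, map_one, mapDomain_monom]

theorem foxDeriv_pow {w : F2} (hw : abVec w = 0) (n : ℕ) :
    foxDeriv (w ^ n) = n * foxDeriv w := by
  induction n with
  | zero => rw [pow_zero, foxDeriv_one, Nat.cast_zero, zero_mul]
  | succ n ih =>
    rw [pow_succ, foxDeriv_mul, monom_of_abVec_eq_zero (by rw [abVec_pow, hw, smul_zero]), ih]
    push_cast
    ring

theorem exists_redDeriv_eq {w : F2} (hw : w ∈ coloringSubgroup π μ M) :
    ∃ h ∈ (abHom π).ker, ∃ F : AddMonoidAlgebra ℤ Q, abVec w = M • abVec h ∧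
      redDeriv π w = (M : AddMonoidAlgebra ℤ Q) * redDeriv π h +
        F * (1 - AddMonoidAlgebra.single (π (abVec yg)) 1) ∧
      ∀ q, (μ q : ℤ) ∣ F.coeff q := by
  have hker : ∀ {w h : F2}, h ∈ (abHom π).ker → abVec w = M • abVec h → w ∈ (abHom π).ker := by
    intro w h hh hw
    rw [mem_ker_abHom] at hh ⊢
    rw [hw, map_nsmul, hh, smul_zero]
  induction hw using Subgroup.closure_induction with
  | mem w hw =>
    rcases hw with (⟨h, hh, rfl⟩ | ⟨h, hh, k, hk, rfl⟩) | ⟨g, rfl⟩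
    · exact ⟨h, hh, 0, abVec_pow h M, by rw [redDeriv_pow hh]; ring, by simp⟩
    · refine ⟨1, one_mem _, 0, ?_, ?_, by simp⟩
      · simp only [abVec_mul, abVec_inv, abVec_one]
        simp
      · rw [redDeriv_mul (mul_mem (mul_mem hh hk) (inv_mem hh)),
          redDeriv_mul (mul_mem hh hk), redDeriv_mul hh, redDeriv_inv hh, redDeriv_inv hk,
          redDeriv_one]
        ring
    · have hp : abVec (commGen ^ μ (π (abVec g))) = 0 := by
        rw [abVec_pow, abVec_commGen, smul_zero]
      refine ⟨1, one_mem _, AddMonoidAlgebra.single (π (abVec g)) (μ (π (abVec g)) : ℤ),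
        ?_, ?_, ?_⟩
      · rw [abVec_conj, hp, abVec_one, smul_zero]
      · rw [redDeriv, foxDeriv_conj hp, foxDeriv_pow abVec_commGen, foxDeriv_commGen, map_mul,
          map_mul, mapDomain_one_sub_monom_yg, mapDomain_monom, map_natCast, redDeriv_one,
          mul_zero, zero_add, ← mul_assoc]
        congr 1
        rw [AddMonoidAlgebra.natCast_def, AddMonoidAlgebra.single_mul_single, add_zero, one_mul]
      · intro q
        classical
        rw [AddMonoidAlgebra.coeff_single, Finsupp.single_apply]
        split_ifs with h
        · rw [h]
        · exact dvd_zero _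
  | one => exact ⟨1, one_mem _, 0, by rw [abVec_one, smul_zero], by simp [redDeriv_one], by simp⟩
  | mul v w _ _ hv hw =>
    obtain ⟨h, hh, F, e1, e2, e3⟩ := hv
    obtain ⟨k, hk, G, e4, e5, e6⟩ := hw
    refine ⟨h * k, mul_mem hh hk, F + G, ?_, ?_, fun q => ?_⟩
    · rw [abVec_mul, abVec_mul, e1, e4, smul_add]
    · rw [redDeriv_mul (hker hh e1), redDeriv_mul hh, e2, e5]
      ring
    · rw [AddMonoidAlgebra.coeff_add]
      exact dvd_add (e3 q) (e6 q)
  | inv w _ hw =>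
    obtain ⟨h, hh, F, e1, e2, e3⟩ := hw
    refine ⟨h⁻¹, inv_mem hh, -F, ?_, ?_, fun q => ?_⟩
    · rw [abVec_inv, abVec_inv, e1, smul_neg]
    · rw [redDeriv_inv (hker hh e1), redDeriv_inv hh, e2]
      ring
    · rw [AddMonoidAlgebra.coeff_neg]
      exact (e3 q).neg_right

theorem coeff_add_nsmul_of_mul_eq_zero {G : AddMonoidAlgebra ℤ Q} {e : Q}
    (hG : G * (1 - AddMonoidAlgebra.single e 1) = 0) (q : Q) (k : ℕ) :
    G.coeff (q + k • e) = G.coeff q := by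
  rw [mul_sub, mul_one, sub_eq_zero] at hG
  induction k with
  | zero => rw [zero_smul, add_zero]
  | succ k ih =>
    conv_lhs => rw [hG]
    rw [AddMonoidAlgebra.coeff_mul_single_apply, mul_one, ← ih, succ_nsmul]
    congr 1
    abel

/-- An automorphism of `F₂` preserving the subgroup attached to a coloring acts on the quotient `Q`
of `ℤ²` by an affine map compatible with the coloring. -/
theorem exists_coloring_dvd (hM : M ≠ 0) (hμM : ∀ q, μ q ∣ M) {k : ℕ}
    (hk : k • π (abVec yg) ≠ 0) (hμ : ∀ q, μ (q + k • π (abVec yg)) = μ q) {γ : F2 ≃* F2}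
    (hγ : (coloringSubgroup π μ M).map γ.toMonoidHom = coloringSubgroup π μ M) :
    ∃ a, ∀ v, μ (π (autMat γ *ᵥ v + a)) ∣ μ (π v) := by
  obtain ⟨a, ε, hε, hγc⟩ := exists_foxDeriv_apply_commGen γ
  refine ⟨a, fun v => ?_⟩
  obtain ⟨g, rfl⟩ : ∃ g, abVec g = v := by
    refine ⟨xg ^ v 0 * yg ^ v 1, ?_⟩
    ext i
    fin_cases i <;> simp [abVec, xg, yg, expSum]
  set m := μ (π (abVec g))
  set b := π (autMat γ *ᵥ abVec g + a)
  have hmem : γ (g * commGen ^ m * g⁻¹) ∈ coloringSubgroup π μ M := by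
    rw [← hγ]
    exact Subgroup.mem_map_of_mem γ.toMonoidHom (conj_mem_coloringSubgroup g)
  obtain ⟨h, -, F, e1, e2, e3⟩ := exists_redDeriv_eq hmem
  have hc0 : abVec (γ commGen) = 0 := by rw [abVec_apply_equiv, abVec_commGen, mulVec_zero]
  have hc0' : abVec (γ commGen ^ m) = 0 := by rw [abVec_pow, hc0, smul_zero]
  have h0 : abVec h = 0 := by
    rw [map_mul, map_mul, map_inv, map_pow, abVec_conj, hc0', eq_comm, smul_eq_zero] at e1
    exact e1.resolve_left hM
  obtain ⟨q, hq, -⟩ := exists_foxDeriv_eq γ h0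
  have hG : (AddMonoidAlgebra.single b (m * ε) -
      (M : AddMonoidAlgebra ℤ Q) * AddMonoidAlgebra.mapDomainRingHom ℤ π q - F) *
      (1 - AddMonoidAlgebra.single (π (abVec yg)) 1) = 0 := by
    have hs : AddMonoidAlgebra.single b (m * ε) =
        AddMonoidAlgebra.single (π (abVec (γ g))) 1 * ((m : AddMonoidAlgebra ℤ Q) *
          AddMonoidAlgebra.single (π a) ε) := by
      rw [AddMonoidAlgebra.natCast_def, AddMonoidAlgebra.single_mul_single,
        AddMonoidAlgebra.single_mul_single, zero_add, one_mul, ← map_add, abVec_apply_equiv]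
    rw [redDeriv, map_mul, map_mul, map_inv, map_pow, foxDeriv_conj hc0', foxDeriv_pow hc0, hγc,
      map_mul, map_mul, map_mul, mapDomain_one_sub_monom_yg, mapDomain_monom, map_natCast,
      AddMonoidAlgebra.mapDomainRingHom_apply _ _ (AddMonoidAlgebra.single a ε),
      AddMonoidAlgebra.mapDomain_single, redDeriv, hq, map_mul, mapDomain_one_sub_monom_yg] at e2
    rw [hs]
    linear_combination e2
  have hcoeff := coeff_add_nsmul_of_mul_eq_zero hG b k
  have hMq : ∀ s, (μ s : ℤ) ∣ ((M : AddMonoidAlgebra ℤ Q) *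
      AddMonoidAlgebra.mapDomainRingHom ℤ π q).coeff s := by
    intro s
    rw [AddMonoidAlgebra.natCast_def, AddMonoidAlgebra.coeff_single_mul_apply]
    exact (Int.natCast_dvd_natCast.2 (hμM s)).mul_right _
  rw [AddMonoidAlgebra.coeff_sub, AddMonoidAlgebra.coeff_sub, AddMonoidAlgebra.coeff_single,
    Finsupp.sub_apply, Finsupp.sub_apply, Finsupp.sub_apply, Finsupp.sub_apply,
    Finsupp.single_eq_same, Finsupp.single_eq_of_ne (by simpa using hk), zero_sub] at hcoeff
  have h1 := hMq (b + k • π (abVec yg))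
  have h2 := e3 (b + k • π (abVec yg))
  rw [hμ] at h1 h2
  have h3 : (μ b : ℤ) ∣ m * ε := by
    have h4 := dvd_sub (dvd_add (hMq b) (e3 b)) (dvd_add h1 h2)
    refine (congrArg ((μ b : ℤ) ∣ ·) ?_).mp h4
    linear_combination hcoeff
  exact Int.natCast_dvd_natCast.1 (hε.dvd_mul_right.1 h3)

end ColoringSubgroup

section Lifts

open Matrix

/-- The automorphism `x ↦ x`, `y ↦ y x` of `F₂`. -/
def shearAut : F2 ≃* F2 :=
  MonoidHom.toMulEquiv (FreeGroup.lift ![xg, yg * xg]) (FreeGroup.lift ![xg, yg * xg⁻¹])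
    (by ext i; fin_cases i <;> simp [xg, yg]) (by ext i; fin_cases i <;> simp [xg, yg])

/-- The automorphism `x ↦ x y x⁻¹`, `y ↦ x⁻¹` of `F₂`. -/
def rotationAut : F2 ≃* F2 :=
  MonoidHom.toMulEquiv (FreeGroup.lift ![xg * yg * xg⁻¹, xg⁻¹])
    (FreeGroup.lift ![yg⁻¹, yg * xg * yg⁻¹])
    (by ext i; fin_cases i <;> simp [xg, yg, mul_assoc])
    (by ext i; fin_cases i <;> simp [xg, yg, mul_assoc])

theorem shearAut_of (i : Fin 2) : shearAut (FreeGroup.of i) = ![xg, yg * xg] i :=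
  FreeGroup.lift_apply_of

theorem rotationAut_of (i : Fin 2) :
    rotationAut (FreeGroup.of i) = ![xg * yg * xg⁻¹, xg⁻¹] i :=
  FreeGroup.lift_apply_of

theorem shearAut_commGen : shearAut commGen = commGen := by
  simp only [commGen, map_mul, map_inv]
  simp only [xg, yg, shearAut_of]
  simp [mul_assoc]

theorem rotationAut_commGen : rotationAut commGen = commGen := by
  simp only [commGen, map_mul, map_inv]
  simp only [xg, yg, rotationAut_of]
  simp [mul_assoc]

theorem autMat_shearAut : autMat shearAut = (ModularGroup.T : SL2Z).val := by
  ext i j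
  fin_cases i <;> fin_cases j <;>
    simp [autMat, shearAut_of, expSum, xg, yg, ModularGroup.T]

theorem autMat_rotationAut : autMat rotationAut = (ModularGroup.S : SL2Z).val := by
  ext i j
  fin_cases i <;> fin_cases j <;>
    simp [autMat, rotationAut_of, expSum, xg, yg, ModularGroup.S]

theorem autMat_inv_eq {γ : F2 ≃* F2} {A : SL2Z} (h : autMat γ = A.val) :
    autMat γ⁻¹ = A⁻¹.val := by
  have h1 : autMat γ⁻¹ * A.val = 1 := by rw [← h, ← autMat_mul, inv_mul_cancel, autMat_one]
  have h2 : A.val * A⁻¹.val = 1 := by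
    rw [← Matrix.SpecialLinearGroup.coe_mul, mul_inv_cancel, Matrix.SpecialLinearGroup.coe_one]
  rw [← mul_one (autMat γ⁻¹), ← h2, ← mul_assoc, h1, one_mul]

theorem inv_apply_eq_self {G : Type*} [Group G] {γ : G ≃* G} {c : G} (h : γ c = c) :
    γ⁻¹ c = c := by
  conv_lhs => rw [← h]
  exact γ.symm_apply_apply c

/-- Every element of `SL₂(ℤ)` lifts to an automorphism of `F₂` fixing `[x, y]`. -/
theorem exists_autMat_eq (A : SL2Z) : ∃ γ : F2 ≃* F2, autMat γ = A.val ∧ γ commGen = commGen := by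
  have hA : A ∈ Subgroup.closure {ModularGroup.S, ModularGroup.T} := by
    rw [SpecialLinearGroup.SL2Z_generators]
    exact Subgroup.mem_top A
  induction hA using Subgroup.closure_induction with
  | mem A hA =>
    rcases hA with rfl | rfl
    · exact ⟨rotationAut, autMat_rotationAut, rotationAut_commGen⟩
    · exact ⟨shearAut, autMat_shearAut, shearAut_commGen⟩
  | one => exact ⟨1, autMat_one, rfl⟩
  | mul A B _ _ hA hB =>
    obtain ⟨γ, hγ, hγc⟩ := hA
    obtain ⟨δ, hδ, hδc⟩ := hB
    refine ⟨γ * δ, by rw [autMat_mul, hγ, hδ, Matrix.SpecialLinearGroup.coe_mul], ?_⟩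
    rw [MulAut.mul_apply, hδc, hγc]
  | inv A _ hA =>
    obtain ⟨γ, hγ, hγc⟩ := hA
    exact ⟨γ⁻¹, autMat_inv_eq hγ, inv_apply_eq_self hγc⟩

end Lifts

section OrbitColoring

open Matrix

variable {p : ℕ}

/-- A positive coloring of a finite set constant exactly on the classes of a setoid. -/
theorem exists_coloring {X : Type*} [Finite X] (r : Setoid X) :
    ∃ m : X → ℕ, (∀ v, m v ≠ 0) ∧ ∀ v w, m v = m w ↔ r v w := by
  have e := Finite.equivFin (Quotient r)
  refine ⟨fun v => e (Quotient.mk r v) + 1, fun v => Nat.succ_ne_zero _, fun v w => ?_⟩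
  simp only [add_left_inj, Fin.val_inj, e.injective.eq_iff]
  exact Quotient.eq

theorem exists_orbit_coloring {F : Type*} [CommRing F] [Finite F]
    (K : Subgroup (Matrix.SpecialLinearGroup (Fin 2) F)) : ∃ m : (Fin 2 → F) → ℕ,
    (∀ v, m v ≠ 0) ∧ ∀ v w, m v = m w ↔ ∃ k ∈ K, k.val *ᵥ w = v := by
  obtain ⟨m, h0, h1⟩ := exists_coloring (X := Fin 2 → F)
    { r := fun v w => ∃ k ∈ K, k.val *ᵥ w = v
      iseqv :=
        { refl := fun v => ⟨1, one_mem K, one_mulVec v⟩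
          symm := by
            rintro v w ⟨k, hk, rfl⟩
            refine ⟨k⁻¹, inv_mem hk, ?_⟩
            rw [mulVec_mulVec, ← Matrix.SpecialLinearGroup.coe_mul, inv_mul_cancel,
              Matrix.SpecialLinearGroup.coe_one, one_mulVec]
          trans := by
            rintro u v w ⟨k, hk, rfl⟩ ⟨l, hl, rfl⟩
            refine ⟨k * l, mul_mem hk hl, ?_⟩
            rw [mulVec_mulVec, Matrix.SpecialLinearGroup.coe_mul] } }
  exact ⟨m, h0, h1⟩

/-- If an affine bijection only lowers a coloring in the sense of divisibility, it preserves it. -/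
theorem coloring_eq_of_dvd {X : Type*} [Finite X] {m : X → ℕ} (hm : ∀ v, m v ≠ 0) {f : X → X}
    (hf : Function.Bijective f) (h : ∀ v, m (f v) ∣ m v) (v : X) : m (f v) = m v := by
  have := Fintype.ofFinite X
  exact (Finset.sum_eq_sum_iff_of_le fun v _ => Nat.le_of_dvd (Nat.pos_of_ne_zero (hm v)) (h v)).1
    (hf.sum_comp m) v (Finset.mem_univ v)

theorem mem_orbitClosure_of_dvd {F : Type*} [CommRing F] [Finite F]
    {K : Subgroup (Matrix.SpecialLinearGroup (Fin 2) F)} {m : (Fin 2 → F) → ℕ}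
    (h0 : ∀ v, m v ≠ 0) (hm : ∀ v w, m v = m w ↔ ∃ k ∈ K, k.val *ᵥ w = v)
    {g : Matrix.SpecialLinearGroup (Fin 2) F} {a : Fin 2 → F}
    (h : ∀ v, m (g.val *ᵥ v + a) ∣ m v) (v : Fin 2 → F) : ∃ k ∈ K, k.val *ᵥ v = g.val *ᵥ v := by
  have hinj : Function.Injective fun v => g.val *ᵥ v + a := by
    intro v w hvw
    have := congrArg (g⁻¹.val *ᵥ ·) (add_right_cancel hvw)
    simpa only [mulVec_mulVec, ← Matrix.SpecialLinearGroup.coe_mul, inv_mul_cancel,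
      Matrix.SpecialLinearGroup.coe_one, one_mulVec] using this
  have heq := coloring_eq_of_dvd h0 (Finite.injective_iff_bijective.1 hinj) h
  have ha : a = 0 := by
    obtain ⟨k, -, hk⟩ := (hm _ _).1 (heq 0)
    rw [mulVec_zero, mulVec_zero, zero_add] at hk
    exact hk.symm
  obtain ⟨k, hk, e⟩ := (hm _ _).1 (heq v)
  exact ⟨k, hk, by rw [e, ha, add_zero]⟩

/-- Reduction of an integer vector modulo `p` and modulo `2 p`. -/
def reduceVec (p : ℕ) : (Fin 2 → ℤ) →+ (Fin 2 → ZMod p) × (Fin 2 → ZMod (2 * p)) where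
  toFun v := (fun i => (v i : ZMod p), fun i => (v i : ZMod (2 * p)))
  map_zero' := by ext <;> simp
  map_add' v w := by ext <;> simp

theorem reduceVec_mulVec_eq_zero (B : Matrix (Fin 2) (Fin 2) ℤ) {v : Fin 2 → ℤ}
    (hv : reduceVec p v = 0) : reduceVec p (B *ᵥ v) = 0 := by
  rw [Prod.ext_iff, funext_iff, funext_iff] at hv ⊢
  obtain ⟨h1, h2⟩ := hv
  simp only [reduceVec, AddMonoidHom.coe_mk, ZeroHom.coe_mk, Prod.fst_zero, Prod.snd_zero,
    Pi.zero_apply] at h1 h2 ⊢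
  constructor <;> intro i <;> simp [mulVec, dotProduct, h1, h2]

theorem reduceVec_mulVec_fst (A : SL2Z) (v : Fin 2 → ℤ) : (reduceVec p (A.val *ᵥ v)).1 =
    (Matrix.SpecialLinearGroup.map (Int.castRingHom (ZMod p)) A).val *ᵥ (reduceVec p v).1 := by
  ext i
  fin_cases i <;> simp [reduceVec, mulVec, dotProduct]

theorem exists_reduceVec_fst (v : Fin 2 → ZMod p) : ∃ w, (reduceVec p w).1 = v := by
  choose w hw using fun i => ZMod.intCast_surjective (v i)
  exact ⟨w, funext hw⟩

theorem add_nsmul_reduceVec_yg_fst (q : (Fin 2 → ZMod p) × (Fin 2 → ZMod (2 * p))) :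
    (q + p • reduceVec p (abVec yg)).1 = q.1 := by
  ext i
  simp

theorem nsmul_reduceVec_yg_ne_zero (hp : p ≠ 0) : p • reduceVec p (abVec yg) ≠ 0 := by
  intro h
  have h1 := congrFun (congrArg Prod.snd h) 1
  have h2 : ((p : ℕ) : ZMod (2 * p)) = 0 := by
    simpa [reduceVec, yg, abVec_of] using h1
  rw [ZMod.natCast_eq_zero_iff] at h2
  have := Nat.le_of_dvd (Nat.pos_of_ne_zero hp) h2
  omega

end OrbitColoring

/-- A subgroup of `SL₂(ℤ)` containing `Γ(p)` whose image in `SL₂(ℤ/p)` is determined by its orbits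
on `(ℤ/p)²` is a Veech group. -/
theorem exists_veechGroup_comap_eq {p : ℕ} (hp : p ≠ 0)
    {K : Subgroup (Matrix.SpecialLinearGroup (Fin 2) (ZMod p))} (hK : orbitClosure K = K) :
    ∃ U : Subgroup F2, U.FiniteIndex ∧ VeechGroup U =
      (K.comap (Matrix.SpecialLinearGroup.map (Int.castRingHom (ZMod p))) : Set SL2Z) := by
  have : NeZero p := ⟨hp⟩
  obtain ⟨m, h0, hm⟩ := exists_orbit_coloring K
  have : NeZero (2 * p) := ⟨mul_ne_zero two_ne_zero hp⟩
  let μ : (Fin 2 → ZMod p) × (Fin 2 → ZMod (2 * p)) → ℕ := fun q => m q.1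
  obtain ⟨M, hM, hdvd⟩ : ∃ M, M ≠ 0 ∧ ∀ v, m v ∣ M :=
    ⟨∏ v, m v, Finset.prod_ne_zero_iff.2 fun v _ => h0 v,
      fun v => Finset.dvd_prod_of_mem m (Finset.mem_univ v)⟩
  refine ⟨coloringSubgroup (reduceVec p) μ M, finiteIndex_coloringSubgroup hM, ?_⟩
  have hle : ∀ A ∈ K.comap (Matrix.SpecialLinearGroup.map (Int.castRingHom (ZMod p))),
      ∀ γ : F2 ≃* F2, autMat γ = A.val → γ commGen = commGen →
      (coloringSubgroup (reduceVec p) μ M).map γ.toMonoidHom ≤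
        coloringSubgroup (reduceVec p) μ M := by
    intro A hA γ hγ hc
    refine map_coloringSubgroup_le hc (fun v hv => reduceVec_mulVec_eq_zero _ hv) fun v => ?_
    refine (hm _ _).2 ⟨_, hA, ?_⟩
    rw [hγ, reduceVec_mulVec_fst]
  ext A
  constructor
  · rintro ⟨γ, ⟨-, hγ⟩, hA⟩
    obtain ⟨a, ha⟩ := exists_coloring_dvd (π := reduceVec p) (μ := μ) hM (fun q => hdvd q.1)
      (nsmul_reduceVec_yg_ne_zero hp)
      (fun q => congrArg m (add_nsmul_reduceVec_yg_fst q)) hγ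
    rw [← hA] at ha
    rw [SetLike.mem_coe, Subgroup.mem_comap, ← hK]
    refine mem_orbitClosure_of_dvd h0 hm (a := (reduceVec p a).1) fun v => ?_
    obtain ⟨w, rfl⟩ := exists_reduceVec_fst v
    have := ha w
    simp only [μ, map_add, Prod.fst_add, reduceVec_mulVec_fst] at this
    exact this
  · intro hA
    obtain ⟨γ, hγ, hc⟩ := exists_autMat_eq A
    refine ⟨γ, ⟨by rw [hγ, A.det_coe], le_antisymm (hle A hA γ hγ hc) ?_⟩, hγ.symm⟩
    intro w hw
    exact ⟨γ⁻¹ w, hle A⁻¹ (inv_mem hA) γ⁻¹ (autMat_inv_eq hγ) (inv_apply_eq_self hc)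
      (Subgroup.mem_map_of_mem _ hw), γ.apply_symm_apply w⟩

/-- Every congruence subgroup `Γ` of `SL₂(ℤ)` of prime level `p` is an origami Veech group,
except possibly when `p ∈ {2,3,5,7,11}` and the index of `Γ` in `SL₂(ℤ)` is `p`. -/
theorem prime_level_congruence_is_veech (p : ℕ) (hp : p.Prime) (Γ : Subgroup SL2Z)
    (hpΓ : CongruenceSubgroup.Gamma p ≤ Γ)
    (hlevel : ∀ n : ℕ, 1 ≤ n → CongruenceSubgroup.Gamma n ≤ Γ → p ≤ n)
    (hnot : ¬ (p ∈ ({2, 3, 5, 7, 11} : Set ℕ) ∧ Γ.index = p)) :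
    ∃ U : Subgroup F2, U.FiniteIndex ∧ VeechGroup U = (Γ : Set SL2Z) := by
  have : Fact p.Prime := ⟨hp⟩
  have hker : (Matrix.SpecialLinearGroup.map (n := Fin 2) (Int.castRingHom (ZMod p))).ker ≤ Γ := hpΓ
  have hcomap := Subgroup.comap_map_eq_self hker
  have hindex := Subgroup.index_comap_of_surjective
    (Γ.map (Matrix.SpecialLinearGroup.map (Int.castRingHom (ZMod p)))) reduction_surjective
  rw [hcomap] at hindex
  rw [hindex] at hnot
  have := exists_veechGroup_comap_eq hp.ne_zero (orbitClosure_eq_self hnot)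
  rwa [hcomap] at this
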